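/- Let n ≥ 1 and let Z ⊂ ℝ^{2n} be the 'ray with two horns': Z = ({(x, 0) : x ≥ 0} ∪ {(−|y|, y) : −1 ≤ y ≤ 1}) × {0}^{2n-2}, where the first factor lies in the (x_1, y_1)-plane. Then Z is symplectically neighbourhood excisable from (ℝ^{2n}, ω_can): for every open neighbourhood U of Z in ℝ^{2n} there exists a symplectomorphism φ from ℝ^{2n} ∖ Z onto ℝ^{2n} that restricts to the identity map on some neighbourhood of ℝ^{2n} ∖ U in ℝ^{2n} ∖ Z. -/

import Mathlib

open Set

noncomputable section

/-- `ℝ^{2n}` presented as `((x₁,y₁), q)` with `q = (x₂,y₂,…,xₙ,yₙ) ∈ ℝ^{2(n-1)}`;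
here `m = n - 1`, so `n ≥ 1` corresponds to arbitrary `m : ℕ`. -/
abbrev EE (m : ℕ) := (ℝ × ℝ) × ((Fin m → ℝ) × (Fin m → ℝ))

/-- The standard symplectic form on `ℝ^{2m}`. -/
def wB (m : ℕ) (u v : (Fin m → ℝ) × (Fin m → ℝ)) : ℝ :=
  ∑ i, (u.1 i * v.2 i - u.2 i * v.1 i)

/-- The standard symplectic form `ω_can` on `ℝ^{2n} = (ℝ × ℝ) × ℝ^{2m}`. -/
def wcan (m : ℕ) (u v : EE m) : ℝ :=
  (u.1.1 * v.1.2 - u.1.2 * v.1.1) + wB m u.2 v.2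

/-- The "ray with two horns"
`Z = ({(x,0) : x ≥ 0} ∪ {(-|y|, y) : -1 ≤ y ≤ 1}) × {0}^{2n-2}`,
with the first factor in the `(x₁,y₁)`-plane. -/
def rayWithHorns (m : ℕ) : Set (EE m) :=
  {z | z.2 = 0 ∧ ((z.1.2 = 0 ∧ 0 ≤ z.1.1) ∨
    (z.1.2 ∈ Icc (-1 : ℝ) 1 ∧ z.1.1 = -|z.1.2|))}

section General

open Filter Topology
open scoped ContDiff NNReal

variable {E : Type*} [NormedAddCommGroup E] [NormedSpace ℝ E]

/-- A smooth perturbation of the identity by a strict contraction is a diffeomorphism. -/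
theorem exists_equiv_id_add [CompleteSpace E] {X : E → E} (hX : ContDiff ℝ ∞ X) {K : ℝ≥0}
    (hK : LipschitzWith K X) (hK1 : K < 1) :
    ∃ e : E ≃ E, (∀ p, e p = p + X p) ∧ ContDiff ℝ ∞ e.symm := by
  have happ : ApproximatesLinearOn (fun p => p + X p)
      ((ContinuousLinearEquiv.refl ℝ E : E ≃L[ℝ] E) : E →L[ℝ] E) univ K := by
    intro x _ y _
    have h := hK.norm_sub_le x y
    have e : x + X x - (y + X y) - ((ContinuousLinearEquiv.refl ℝ E : E ≃L[ℝ] E) : E →L[ℝ] E)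
        (x - y) = X x - X y := by
      simp only [ContinuousLinearEquiv.coe_refl, ContinuousLinearMap.coe_id', id]
      abel
    rw [e]
    exact h
  have hc : Subsingleton E ∨
      K < ‖((ContinuousLinearEquiv.refl ℝ E : E ≃L[ℝ] E).symm : E →L[ℝ] E)‖₊⁻¹ := by
    rcases subsingleton_or_nontrivial E with h | h
    · exact Or.inl h
    · right
      have : ‖((ContinuousLinearEquiv.refl ℝ E : E ≃L[ℝ] E).symm : E →L[ℝ] E)‖₊ = 1 := by
        exact ContinuousLinearMap.nnnorm_id
      rw [this]
      simpa using hK1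
  let H : E ≃ₜ E := happ.toHomeomorph _ hc
  have hH : ∀ p, H p = p + X p := fun p => rfl
  have hnorm : ∀ p, ‖-(fderiv ℝ X p)‖ < 1 := fun p => by
    rw [norm_neg]
    exact (norm_fderiv_le_of_lipschitz ℝ hK).trans_lt (by exact_mod_cast hK1)
  have hder : ∀ p, HasFDerivAt H
      (ContinuousLinearEquiv.ofUnit (Units.oneSub (-(fderiv ℝ X p)) (hnorm p)) : E →L[ℝ] E) p := by
    intro p
    have h1 : HasFDerivAt H (ContinuousLinearMap.id ℝ E + fderiv ℝ X p) p :=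
      (hasFDerivAt_id (𝕜 := ℝ) p).add ((hX.differentiable (by simp)) p).hasFDerivAt
    have h2 : (ContinuousLinearEquiv.ofUnit (Units.oneSub (-(fderiv ℝ X p)) (hnorm p)) :
        E →L[ℝ] E) = ContinuousLinearMap.id ℝ E + fderiv ℝ X p := by
      ext u
      change ((Units.oneSub (-(fderiv ℝ X p)) (hnorm p) : (E →L[ℝ] E)ˣ) : E →L[ℝ] E) u = _
      simp
    rwa [h2]
  exact ⟨H.toEquiv, hH, H.contDiff_symm hder (contDiff_id.add hX)⟩

variable (Ω : E →ₗ[ℝ] E →ₗ[ℝ] ℝ)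

/-- Symplectomorphisms of a vector space equipped with a bilinear form. -/
structure SympEquiv extends E ≃ E where
  contDiff_toFun : ContDiff ℝ ∞ toFun
  contDiff_invFun : ContDiff ℝ ∞ invFun
  symp : ∀ p u v, Ω (fderiv ℝ toFun p u) (fderiv ℝ toFun p v) = Ω u v

namespace SympEquiv

variable {Ω}

/-- The identity symplectomorphism. -/
def refl : SympEquiv Ω where
  toEquiv := Equiv.refl E
  contDiff_toFun := contDiff_id
  contDiff_invFun := contDiff_id
  symp p u v := by
    change Ω (fderiv ℝ id p u) (fderiv ℝ id p v) = _
    simp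

/-- Composition of symplectomorphisms, first `φ` and then `ψ`. -/
def trans (φ ψ : SympEquiv Ω) : SympEquiv Ω where
  toEquiv := φ.toEquiv.trans ψ.toEquiv
  contDiff_toFun := ψ.contDiff_toFun.comp φ.contDiff_toFun
  contDiff_invFun := φ.contDiff_invFun.comp ψ.contDiff_invFun
  symp p u v := by
    change Ω (fderiv ℝ (ψ.toFun ∘ φ.toFun) p u) (fderiv ℝ (ψ.toFun ∘ φ.toFun) p v) = _
    rw [fderiv_comp p (ψ.contDiff_toFun.differentiable (by simp) _)
      (φ.contDiff_toFun.differentiable (by simp) _)]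
    simp only [ContinuousLinearMap.comp_apply]
    rw [ψ.symp, φ.symp]

end SympEquiv

/-- If `id - X` and `id + X` are diffeomorphisms and the derivative of `X` is infinitesimally
symplectic, then the Cayley transform `(id + X) ∘ (id - X)⁻¹` is a symplectomorphism. -/
theorem exists_sympEquiv_cayley {X : E → E} (hX : ContDiff ℝ ∞ X)
    (hanti : ∀ p u w, Ω (fderiv ℝ X p u) w + Ω u (fderiv ℝ X p w) = 0)
    (A B : E ≃ E) (hA : ∀ p, A p = p - X p) (hB : ∀ p, B p = p + X p)
    (hA' : ContDiff ℝ ∞ A.symm) (hB' : ContDiff ℝ ∞ B.symm) :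
    ∃ φ : SympEquiv Ω, ∀ p, φ.toEquiv (A p) = B p := by
  have hAf : (A : E → E) = fun p => p - X p := funext hA
  have hBf : (B : E → E) = fun p => p + X p := funext hB
  have hAs : ContDiff ℝ ∞ A := hAf ▸ contDiff_id.sub hX
  have hBs : ContDiff ℝ ∞ B := hBf ▸ contDiff_id.add hX
  have hXd : Differentiable ℝ X := hX.differentiable (by simp)
  have hAd : ∀ p u, fderiv ℝ A p u = u - fderiv ℝ X p u := by
    intro p u
    rw [hAf, fderiv_fun_sub differentiableAt_fun_id (hXd p)]
    simp
  have hBd : ∀ p u, fderiv ℝ B p u = u + fderiv ℝ X p u := by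
    intro p u
    rw [hBf, fderiv_fun_add differentiableAt_fun_id (hXd p)]
    simp
  have key : ∀ p u w, Ω (fderiv ℝ B p u) (fderiv ℝ B p w) =
      Ω (fderiv ℝ A p u) (fderiv ℝ A p w) := by
    intro p u w
    have h := hanti p u w
    simp only [hAd, hBd, map_add, map_sub, LinearMap.add_apply, LinearMap.sub_apply]
    linarith
  refine ⟨⟨A.symm.trans B, hBs.comp hA', hAs.comp hB', ?_⟩, fun p => by simp⟩
  intro p u w
  change Ω (fderiv ℝ (B ∘ A.symm) p u) (fderiv ℝ (B ∘ A.symm) p w) = _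
  have hid : ∀ u, fderiv ℝ A (A.symm p) (fderiv ℝ A.symm p u) = u := by
    intro u
    have h1 : fderiv ℝ (A ∘ A.symm) p = ContinuousLinearMap.id ℝ E := by
      have : (A ∘ A.symm : E → E) = id := by ext; simp
      rw [this, fderiv_id]
    rw [fderiv_comp p (hAs.differentiable (by simp) _) (hA'.differentiable (by simp) _)] at h1
    exact DFunLike.congr_fun h1 u
  rw [fderiv_comp p (hBs.differentiable (by simp) _) (hA'.differentiable (by simp) _)]
  simp only [ContinuousLinearMap.comp_apply]
  rw [key, hid, hid]

/-- The closed ray on the line spanned by `v`, starting at `a • v`. -/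
def rayFrom (v : E) (a : ℝ) : Set E := (fun t : ℝ => t • v) '' Ici a

theorem smul_mem_rayFrom {v : E} (hv : v ≠ 0) {a t : ℝ} : t • v ∈ rayFrom v a ↔ a ≤ t := by
  constructor
  · rintro ⟨s, hs, h⟩
    have : s = t := smul_left_injective ℝ hv h
    exact this ▸ hs
  · exact fun h => ⟨t, h, rfl⟩

theorem isClosed_rayFrom {v : E} (hv : v ≠ 0) (a : ℝ) : IsClosed (rayFrom v a) :=
  (isClosedEmbedding_smul_left hv).isClosedMap _ isClosed_Ici

/-- A bijection of the form `id + X` which moves the points of a line monotonically along that line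
maps rays on the line to rays. -/
theorem mem_rayFrom_iff_of_lipschitz {v : E} (hv : v ≠ 0) {X : E → E} {K : ℝ≥0}
    (hK : LipschitzWith K X) (hK1 : K < 1) {g : ℝ → ℝ} (hg : ContDiff ℝ ∞ g)
    (hgX : ∀ t : ℝ, X (t • v) = g t • v) (F : E ≃ E) (hF : ∀ p, F p = p + X p) (m : ℝ) (q : E) :
    F q ∈ rayFrom v (m + g m) ↔ q ∈ rayFrom v m := by
  have hgK : LipschitzWith K g := by
    refine LipschitzWith.of_dist_le_mul fun s t => ?_
    have h := hK.norm_sub_le (s • v) (t • v)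
    rw [hgX, hgX, ← sub_smul, ← sub_smul, norm_smul, norm_smul, ← mul_assoc] at h
    exact le_of_mul_le_mul_right h (norm_pos_iff.2 hv)
  obtain ⟨e, he, -⟩ := exists_equiv_id_add hg hgK hK1
  have hmono : ∀ s t : ℝ, s ≤ t → s + g s ≤ t + g t := by
    intro s t hst
    have h := hgK.dist_le_mul s t
    rw [Real.dist_eq, Real.dist_eq, abs_sub_comm s t, abs_of_nonneg (sub_nonneg.2 hst)] at h
    have h1 := (abs_le.1 h).2
    have hK1' : (K : ℝ) ≤ 1 := by exact_mod_cast hK1.le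
    nlinarith [mul_le_mul_of_nonneg_right hK1' (sub_nonneg.2 hst)]
  have hFl : ∀ t : ℝ, F (t • v) = (t + g t) • v := fun t => by rw [hF, hgX, add_smul]
  constructor
  · rintro ⟨s, hs, h⟩
    have hs' : s = e.symm s + g (e.symm s) := by rw [← he, e.apply_symm_apply]
    have hq : q = (e.symm s) • v := F.injective (by rw [hFl, ← hs']; exact h.symm)
    rw [hq, smul_mem_rayFrom hv]
    by_contra! hlt
    have h2 := hmono _ _ hlt.le
    rw [← hs'] at h2
    have h3 : s = m + g m := le_antisymm h2 hs
    have h4 : e (e.symm s) = e m := by rw [e.apply_symm_apply, he, h3]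
    exact hlt.ne (e.injective h4)
  · rintro ⟨t, ht, rfl⟩
    change F (t • v) ∈ _
    rw [hFl, smul_mem_rayFrom hv]
    exact hmono _ _ ht

variable {Ω}

/-- The Hamiltonian vector field of `χ * Ω v`, for a cutoff function `χ` equal to one near a segment
on the line spanned by `v`, together with the properties used to integrate it. -/
theorem exists_cutoff_field [FiniteDimensional ℝ E] (hΩ : ∀ u, Ω u u = 0)
    (hnd : ∀ w, (∀ u, Ω w u = 0) → w = 0) (J : (E →L[ℝ] ℝ) →L[ℝ] E)
    (hJ : ∀ α u, Ω (J α) u = α u) (v : E) (a b : ℝ) {V : Set E}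
    (hV : IsOpen V) (hab : ∀ t ∈ Icc a b, t • v ∈ V) :
    ∃ (X : E → E) (g : ℝ → ℝ) (C : Set E), ContDiff ℝ ∞ X ∧ ContDiff ℝ ∞ g ∧ IsCompact C ∧ C ⊆ V ∧
      (∀ p ∉ C, X p = 0) ∧
      (∀ p u w, Ω (fderiv ℝ X p u) w + Ω u (fderiv ℝ X p w) = 0) ∧
      (∀ t : ℝ, X (t • v) = g t • v) ∧ ∀ t ∈ Icc a b, g t = 1 := by
  have hseg : IsCompact ((fun t : ℝ => t • v) '' Icc a b) :=
    isCompact_Icc.image (by fun_prop)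
  obtain ⟨C, hC, hsC, hCV⟩ := exists_compact_between hseg hV (by
    rintro _ ⟨t, ht, rfl⟩
    exact hab t ht)
  obtain ⟨χ, hχ1, hχ0, -⟩ := exists_contMDiffMap_one_nhds_of_subset_interior
    (modelWithCornersSelf ℝ E) (n := ⊤) hseg.isClosed hsC
  have hχ : ContDiff ℝ ∞ χ := χ.contMDiff.contDiff
  let l : E →L[ℝ] ℝ := (Ω v).toContinuousLinearMap
  have hl : ∀ u, l u = Ω v u := fun u => rfl
  let S : E → ℝ := fun p => χ p * l p
  have hS : ContDiff ℝ ∞ S := hχ.mul l.contDiff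
  have hdS : ContDiff ℝ ∞ (fderiv ℝ S) := hS.fderiv_right (by simp)
  have hXd : ∀ p u, fderiv ℝ (fun p => J (fderiv ℝ S p)) p u = J (fderiv ℝ (fderiv ℝ S) p u) := by
    intro p u
    have h := J.hasFDerivAt.comp p (hdS.differentiable (by simp) p).hasFDerivAt
    have h2 : fderiv ℝ (fun p => J (fderiv ℝ S p)) p = J.comp (fderiv ℝ (fderiv ℝ S) p) := h.fderiv
    rw [h2]
    rfl
  have hskew : ∀ u w, Ω u w = - Ω w u := by
    intro u w
    have h := hΩ (u + w)
    simp only [map_add, LinearMap.add_apply, hΩ] at h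
    linarith
  refine ⟨fun p => J (fderiv ℝ S p), fun t => χ (t • v), C, J.contDiff.comp hdS,
    hχ.comp (contDiff_id.smul contDiff_const), hC, hCV, ?_, ?_, ?_, ?_⟩
  · intro p hp
    have h : S =ᶠ[𝓝 p] fun _ => 0 := by
      filter_upwards [hC.isClosed.isOpen_compl.mem_nhds hp] with q hq
      simp [S, hχ0 q hq]
    change J (fderiv ℝ S p) = 0
    rw [h.fderiv_eq]
    simp
  · intro p u w
    have hsymm : fderiv ℝ (fderiv ℝ S) p u w = fderiv ℝ (fderiv ℝ S) p w u :=
      (hS.contDiffAt.isSymmSndFDerivAt (by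
        rw [minSmoothness_of_isRCLikeNormedField]
        exact WithTop.coe_le_coe.2 le_top)) u w
    rw [hskew u, hXd, hXd, hJ, hJ, hsymm]
    ring
  · intro t
    have h : fderiv ℝ S (t • v) = χ (t • v) • l := by
      have h := ((hχ.differentiable (by simp) (t • v)).hasFDerivAt.mul l.hasFDerivAt).fderiv
      have h2 : fderiv ℝ S (t • v) = χ (t • v) • l + l (t • v) • fderiv ℝ χ (t • v) := h
      rw [h2, hl]
      simp [hΩ]
    have hv : J l = v := by
      refine sub_eq_zero.1 (hnd _ fun u => ?_)
      rw [map_sub, LinearMap.sub_apply, hJ, hl, sub_self]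
    change J (fderiv ℝ S (t • v)) = χ (t • v) • v
    rw [h, map_smul, hv]
  · intro t ht
    exact hχ1.self_of_nhdsSet _ ⟨t, ht, rfl⟩

/-- There is a symplectomorphism supported near a given segment on the line spanned by `v` which
pushes the ray starting at one end of the segment onto the ray starting at the other end. -/
theorem exists_sympEquiv_push [FiniteDimensional ℝ E] (hΩ : ∀ u, Ω u u = 0)
    (hnd : ∀ w, (∀ u, Ω w u = 0) → w = 0) (J : (E →L[ℝ] ℝ) →L[ℝ] E)
    (hJ : ∀ α u, Ω (J α) u = α u) {v : E} (hv : v ≠ 0) {a b : ℝ} (hle : a ≤ b) {V : Set E}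
    (hV : IsOpen V) (hab : ∀ t ∈ Icc a b, t • v ∈ V) :
    ∃ (φ : SympEquiv Ω) (C : Set E), IsClosed C ∧ C ⊆ V ∧ (∀ p ∉ C, φ.toEquiv p = p) ∧
      ∀ p, φ.toEquiv p ∈ rayFrom v b ↔ p ∈ rayFrom v a := by
  obtain ⟨X, g, C, hX, hg, hC, hCV, hX0, hanti, hXg, hg1⟩ :=
    exists_cutoff_field hΩ hnd J hJ v a b hV hab
  obtain ⟨K, hK⟩ := hX.lipschitzWith_of_hasCompactSupport (HasCompactSupport.intro hC hX0)
    (by simp)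
  obtain ⟨n, hn⟩ := exists_nat_gt ((b - a) / 2 * K)
  have hn0 : (0 : ℝ) < n := lt_of_le_of_lt (by have := sub_nonneg.2 hle; positivity) hn
  set τ : ℝ := (b - a) / (2 * n) with hτ
  have hτ0 : 0 ≤ τ := div_nonneg (sub_nonneg.2 hle) (by positivity)
  have hτb : a + n * (2 * τ) = b := by
    rw [hτ]
    field_simp
    ring
  have hτK : τ * K < 1 := by
    rw [hτ, div_mul_eq_mul_div, div_lt_one (by positivity)]
    linarith
  have hlip : ∀ c : ℝ, |c| = τ → LipschitzWith (‖c‖₊ * K) (fun p => c • X p) ∧ ‖c‖₊ * K < 1 := by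
    intro c hc
    refine ⟨(lipschitzWith_smul c).comp hK, ?_⟩
    rw [← NNReal.coe_lt_coe]
    simpa [hc] using hτK
  have hcX : ∀ c : ℝ, ContDiff ℝ ∞ (fun p => c • X p) := fun c => contDiff_const.smul hX
  have hA := hlip (-τ) (by rw [abs_neg, abs_of_nonneg hτ0])
  have hB := hlip τ (abs_of_nonneg hτ0)
  obtain ⟨A, hAe, hA'⟩ := exists_equiv_id_add (hcX (-τ)) hA.1 hA.2
  obtain ⟨B, hBe, hB'⟩ := exists_equiv_id_add (hcX τ) hB.1 hB.2
  have hanti' : ∀ p u w, Ω (fderiv ℝ (fun p => τ • X p) p u) w +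
      Ω u (fderiv ℝ (fun p => τ • X p) p w) = 0 := by
    intro p u w
    rw [fderiv_fun_const_smul (hX.differentiable (by simp) p)]
    simp only [smul_apply, map_smul, LinearMap.smul_apply, smul_eq_mul]
    rw [← mul_add, hanti, mul_zero]
  obtain ⟨φ, hφ⟩ := exists_sympEquiv_cayley Ω (hcX τ) hanti' A B
    (fun p => by rw [hAe, neg_smul, sub_eq_add_neg]) hBe hA' hB'
  have hφC : ∀ p ∉ C, φ.toEquiv p = p := by
    intro p hp
    have h := hφ p
    rwa [hAe, hBe, hX0 p hp, smul_zero, smul_zero, add_zero] at h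
  have hray : ∀ s : ℝ, a ≤ s → s + 2 * τ ≤ b →
      ∀ p, φ.toEquiv p ∈ rayFrom v (s + 2 * τ) ↔ p ∈ rayFrom v s := by
    intro s has hsb p
    obtain ⟨q, rfl⟩ := A.surjective p
    have h1 := mem_rayFrom_iff_of_lipschitz hv hA.1 hA.2 (g := fun t => -τ * g t)
      (contDiff_const.mul hg) (fun t => by rw [hXg, smul_smul]) A hAe (s + τ) q
    have h2 := mem_rayFrom_iff_of_lipschitz hv hB.1 hB.2 (g := fun t => τ * g t)
      (contDiff_const.mul hg) (fun t => by rw [hXg, smul_smul]) B hBe (s + τ) q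
    rw [hg1 (s + τ) ⟨by linarith, by linarith⟩] at h1 h2
    rw [show s + τ + -τ * 1 = s by ring] at h1
    rw [show s + τ + τ * 1 = s + 2 * τ by ring] at h2
    rw [hφ, h1, h2]
  have hiter : ∀ i : ℕ, i ≤ n → ∃ ψ : SympEquiv Ω, (∀ p ∉ C, ψ.toEquiv p = p) ∧
      ∀ p, ψ.toEquiv p ∈ rayFrom v (a + i * (2 * τ)) ↔ p ∈ rayFrom v a := by
    intro i
    induction i with
    | zero => exact fun _ => ⟨SympEquiv.refl, fun p _ => rfl, fun p => by simp [SympEquiv.refl]⟩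
    | succ i ih =>
      intro hi
      obtain ⟨ψ, hψC, hψ⟩ := ih (Nat.le_of_succ_le hi)
      have hi' : (i : ℝ) + 1 ≤ n := by exact_mod_cast hi
      refine ⟨ψ.trans φ, fun p hp => ?_, fun p => ?_⟩
      · change φ.toEquiv (ψ.toEquiv p) = p
        rw [hψC p hp, hφC p hp]
      · change φ.toEquiv (ψ.toEquiv p) ∈ _ ↔ _
        rw [← hψ, ← hray (a + i * (2 * τ)) (by have : 0 ≤ (i : ℝ) * (2 * τ) := by positivity
                                               linarith) (by nlinarith)]
        push_cast
        rw [show a + (i : ℝ) * (2 * τ) + 2 * τ = a + (i + 1) * (2 * τ) by ring]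
  obtain ⟨ψ, hψC, hψ⟩ := hiter n le_rfl
  rw [hτb] at hψ
  exact ⟨ψ, C, hC.isClosed, hCV, hψC, hψ⟩

/-- A sequence of functions which is locally eventually constant near every point of `S` has a
pointwise limit which locally agrees with the functions of the sequence. -/
theorem exists_locally_eventually_eq {X : Type*} [TopologicalSpace X] [T2Space X] [Nonempty X]
    (F : ℕ → X → X) (S : Set X)
    (h : ∀ p ∈ S, ∃ K, ∀ᶠ q in 𝓝 p, ∀ k ≥ K, F k q = F K q) :
    ∃ f : X → X, ∀ p ∈ S, ∃ K, ∀ k ≥ K, f =ᶠ[𝓝 p] F k := by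
  refine ⟨fun p => limUnder atTop fun k => F k p, fun p hp => ?_⟩
  obtain ⟨K, hK⟩ := h p hp
  refine ⟨K, fun k hk => ?_⟩
  filter_upwards [hK] with q hq
  rw [hq k hk]
  exact (tendsto_atTop_of_eventually_const hq).limUnder_eq

variable (Ω) in
/-- `Z` can be excised from the open set `W` by a symplectomorphism which is the identity near the
complement of `U`. -/
def Excisable (W Z U : Set E) : Prop :=
  ∃ f g : E → E, MapsTo f (W \ Z) W ∧ MapsTo g W (W \ Z) ∧
    (∀ p ∈ W \ Z, g (f p) = p) ∧ (∀ q ∈ W, f (g q) = q) ∧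
    (∀ p ∈ W \ Z, ContDiffAt ℝ ∞ f p) ∧ (∀ q ∈ W, ContDiffAt ℝ ∞ g q) ∧
    (∀ p ∈ W \ Z, ∀ u v, Ω (fderiv ℝ f p u) (fderiv ℝ f p v) = Ω u v) ∧
    ∃ N, IsOpen N ∧ W \ U ⊆ N ∧ ∀ p ∈ N ∩ (W \ Z), f p = p

theorem Excisable.union {W Z₁ Z₂ U : Set E} (h₁ : Excisable Ω W Z₁ U)
    (h₂ : Excisable Ω (W \ Z₁) Z₂ U) (hZU : Z₁ ⊆ U) : Excisable Ω W (Z₁ ∪ Z₂) U := by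
  obtain ⟨f₁, g₁, hf₁, hg₁, hgf₁, hfg₁, hfs₁, hgs₁, hsymp₁, N₁, hN₁, hUN₁, hid₁⟩ := h₁
  obtain ⟨f₂, g₂, hf₂, hg₂, hgf₂, hfg₂, hfs₂, hgs₂, hsymp₂, N₂, hN₂, hUN₂, hid₂⟩ := h₂
  rw [Excisable, ← sdiff_sdiff]
  refine ⟨f₁ ∘ f₂, g₂ ∘ g₁, hf₁.comp hf₂, hg₂.comp hg₁, fun p hp => ?_, fun q hq => ?_,
    fun p hp => (hfs₁ _ (hf₂ hp)).comp p (hfs₂ p hp),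
    fun q hq => (hgs₂ _ (hg₁ hq)).comp q (hgs₁ q hq), fun p hp u v => ?_,
    N₁ ∩ N₂, hN₁.inter hN₂, fun p hp => ⟨hUN₁ hp, hUN₂ ⟨⟨hp.1, fun h => hp.2 (hZU h)⟩, hp.2⟩⟩, ?_⟩
  · simp only [Function.comp_apply]
    rw [hgf₁ _ (hf₂ hp), hgf₂ p hp]
  · simp only [Function.comp_apply]
    rw [hfg₂ _ (hg₁ hq), hfg₁ q hq]
  · rw [fderiv_comp p ((hfs₁ _ (hf₂ hp)).differentiableAt (by simp))
      ((hfs₂ p hp).differentiableAt (by simp))]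
    simp only [ContinuousLinearMap.comp_apply]
    rw [hsymp₁ _ (hf₂ hp), hsymp₂ p hp]
  · rintro p ⟨⟨hp₁, hp₂⟩, hp⟩
    have h := hid₂ p ⟨hp₂, hp⟩
    simp only [Function.comp_apply]
    rw [h]
    exact hid₁ p ⟨hp₁, hp.1⟩

/-- A bijection supported in `C` preserves every set containing `C`. -/
theorem Equiv.apply_mem_iff_of_eq_off {X : Type*} (e : X ≃ X) {C O : Set X} (hCO : C ⊆ O)
    (he : ∀ p ∉ C, e p = p) (p : X) : e p ∈ O ↔ p ∈ O := by
  by_cases hp : p ∈ C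
  · refine ⟨fun _ => hCO hp, fun _ => ?_⟩
    by_contra h
    have h2 := e.injective (he (e p) fun h' => h (hCO h'))
    rw [h2] at h
    exact h (hCO hp)
  · rw [he p hp]

/-- Consecutive pushes along the segments `[a k, a (k + 1)]`, each supported in the image of a small
neighbourhood of the ray under the composition of the previous ones. -/
theorem exists_push_sequence [FiniteDimensional ℝ E] (hΩ : ∀ u, Ω u u = 0)
    (hnd : ∀ w, (∀ u, Ω w u = 0) → w = 0) (J : (E →L[ℝ] ℝ) →L[ℝ] E)
    (hJ : ∀ α u, Ω (J α) u = α u) {v : E} (hv : v ≠ 0) {O : Set E}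
    {a : ℕ → ℝ} (ha : Monotone a) {V : ℕ → Set E} (hV : ∀ k, IsOpen (V k)) (hVO : ∀ k, V k ⊆ O)
    (hseg : ∀ k, ∀ t ∈ Icc (a k) (a (k + 1)), t • v ∈ V k) :
    ∃ (Φ ψ : ℕ → SympEquiv Ω) (C : ℕ → Set E), (∀ p, (Φ 0).toEquiv p = p) ∧
      (∀ k, Φ (k + 1) = (Φ k).trans (ψ k)) ∧ (∀ k, IsClosed (C k)) ∧ (∀ k, C k ⊆ V k) ∧
      (∀ k, ∀ p ∉ C k, (ψ k).toEquiv p = p) ∧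
      (∀ k, ∀ p, (Φ k).toEquiv p ∈ C k →
        p ∈ Metric.thickening (1 / ((k : ℝ) + 1)) (rayFrom v (a 0) ∩ O)) ∧
      ∀ k p, (Φ k).toEquiv p ∈ rayFrom v (a k) ∩ O ↔ p ∈ rayFrom v (a 0) ∩ O := by
  set Z := rayFrom v (a 0) ∩ O with hZ
  have step : ∀ (k : ℕ) (B : Set E), ∃ φ : SympEquiv Ω, IsOpen B →
      (∀ t ∈ Icc (a k) (a (k + 1)), t • v ∈ B) →
      ∃ C, IsClosed C ∧ C ⊆ B ∧ (∀ p ∉ C, φ.toEquiv p = p) ∧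
        ∀ p, φ.toEquiv p ∈ rayFrom v (a (k + 1)) ↔ p ∈ rayFrom v (a k) := by
    intro k B
    by_cases h : IsOpen B ∧ ∀ t ∈ Icc (a k) (a (k + 1)), t • v ∈ B
    · obtain ⟨φ, hφ⟩ := exists_sympEquiv_push hΩ hnd J hJ hv (ha k.le_succ) h.1 h.2
      exact ⟨φ, fun _ _ => hφ⟩
    · exact ⟨SympEquiv.refl, fun h1 h2 => absurd ⟨h1, h2⟩ h⟩
  choose φ hφ using step
  let T : ℕ → SympEquiv Ω → Set E := fun k Ψ =>
    V k ∩ Ψ.toEquiv.symm ⁻¹' Metric.thickening (1 / ((k : ℝ) + 1)) Z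
  let Φ : ℕ → SympEquiv Ω :=
    fun k => Nat.rec SympEquiv.refl (fun k Ψ => Ψ.trans (φ k (T k Ψ))) k
  have hT : ∀ k, IsOpen (T k (Φ k)) := fun k =>
    (hV k).inter (Metric.isOpen_thickening.preimage (Φ k).contDiff_invFun.continuous)
  have good : ∀ k, (∀ p, (Φ k).toEquiv p ∈ rayFrom v (a k) ∩ O ↔ p ∈ Z) →
      ∀ t ∈ Icc (a k) (a (k + 1)), t • v ∈ T k (Φ k) := by
    intro k hk t ht
    refine ⟨hseg k t ht, Metric.self_subset_thickening (by positivity) _ ?_⟩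
    rw [← hk, Equiv.apply_symm_apply]
    exact ⟨(smul_mem_rayFrom hv).2 ht.1, hVO k (hseg k t ht)⟩
  have inv : ∀ k p, (Φ k).toEquiv p ∈ rayFrom v (a k) ∩ O ↔ p ∈ Z := by
    intro k
    induction k with
    | zero => exact fun p => Iff.rfl
    | succ k ih =>
      intro p
      obtain ⟨C, -, hCT, hid, hray⟩ := hφ k _ (hT k) (good k ih)
      rw [← ih]
      change (φ k (T k (Φ k))).toEquiv ((Φ k).toEquiv p) ∈ _ ↔ _
      rw [mem_inter_iff, mem_inter_iff, hray,
        Equiv.apply_mem_iff_of_eq_off _ (fun q hq => hVO k (hCT hq).1) hid]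
  choose C hC hCT hid _ using fun k => hφ k _ (hT k) (good k (inv k))
  refine ⟨Φ, fun k => φ k (T k (Φ k)), C, fun p => rfl, fun k => rfl, hC,
    fun k p hp => (hCT k hp).1, hid, fun k p hp => ?_, inv⟩
  have h := (hCT k hp).2
  rwa [mem_preimage, Equiv.symm_apply_apply] at h

/-- A relatively closed piece of a ray on a line can be excised from `W` if it is covered by a
sequence of consecutive segments leaving every compact subset of `W`. -/
theorem excisable_rayFrom_inter [FiniteDimensional ℝ E] (hΩ : ∀ u, Ω u u = 0)
    (hnd : ∀ w, (∀ u, Ω w u = 0) → w = 0) (J : (E →L[ℝ] ℝ) →L[ℝ] E)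
    (hJ : ∀ α u, Ω (J α) u = α u) {v : E} (hv : v ≠ 0) {W O U : Set E} (hOW : O ⊆ W)
    {a : ℕ → ℝ} (ha : Monotone a) {V : ℕ → Set E} (hV : ∀ k, IsOpen (V k)) (hVO : ∀ k, V k ⊆ O)
    (hVU : ∀ k, V k ⊆ U) (hseg : ∀ k, ∀ t ∈ Icc (a k) (a (k + 1)), t • v ∈ V k)
    (hfin : ∀ q ∈ W, ∃ K, ∀ᶠ q' in 𝓝 q, ∀ k ≥ K, q' ∉ V k)
    (hO : ∀ t : ℝ, t • v ∈ O → ∃ k, t < a k)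
    (hcl : W ∩ closure (rayFrom v (a 0) ∩ O) ⊆ rayFrom v (a 0) ∩ O) :
    Excisable Ω W (rayFrom v (a 0) ∩ O) U := by
  obtain ⟨Φ, ψ, C, hΦ0, hΦs, hC, hCV, hid, hCZ, hray⟩ :=
    exists_push_sequence hΩ hnd J hJ hv ha hV hVO hseg
  set Z := rayFrom v (a 0) ∩ O
  have hΦs' : ∀ k p, (Φ (k + 1)).toEquiv p = (ψ k).toEquiv ((Φ k).toEquiv p) := fun k p => by
    rw [hΦs]
    rfl
  have hΦs'' : ∀ k p, (Φ (k + 1)).toEquiv.symm p = (Φ k).toEquiv.symm ((ψ k).toEquiv.symm p) :=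
    fun k p => by
      rw [hΦs]
      rfl
  have hW : ∀ k p, (Φ k).toEquiv p ∈ W ↔ p ∈ W := by
    intro k
    induction k with
    | zero => exact fun p => by rw [hΦ0]
    | succ k ih =>
      intro p
      rw [hΦs', Equiv.apply_mem_iff_of_eq_off _ (fun q hq => hOW (hVO k (hCV k hq))) (hid k), ih]
  have hW' : ∀ k q, (Φ k).toEquiv.symm q ∈ W ↔ q ∈ W := fun k q => by
    rw [← hW k, Equiv.apply_symm_apply]
  have hf : ∀ p ∈ W \ Z, ∃ K, ∀ᶠ q in 𝓝 p, ∀ k ≥ K, (Φ k).toEquiv q = (Φ K).toEquiv q := by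
    intro p hp
    have hp' : p ∉ closure Z := fun h => hp.2 (hcl ⟨hp.1, h⟩)
    obtain ⟨ε, hε, hball⟩ := Metric.isOpen_iff.1 isClosed_closure.isOpen_compl p hp'
    obtain ⟨K, hK⟩ := exists_nat_one_div_lt (half_pos hε)
    refine ⟨K, ?_⟩
    filter_upwards [Metric.ball_mem_nhds p (half_pos hε)] with q hq k hk
    induction k, hk using Nat.le_induction with
    | base => rfl
    | succ k hk ih =>
      rw [hΦs', hid k _ fun h => ?_, ih]
      obtain ⟨z, hz, hqz⟩ := Metric.mem_thickening_iff.1 (hCZ k q h)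
      have h1 : 1 / ((k : ℝ) + 1) ≤ 1 / ((K : ℝ) + 1) := by
        have : (K : ℝ) ≤ k := by exact_mod_cast hk
        gcongr
      refine hball (a := z) ?_ (subset_closure hz)
      rw [Metric.mem_ball] at hq ⊢
      have := dist_triangle_left z p q
      linarith
  have hg : ∀ q ∈ W, ∃ K, ∀ᶠ q' in 𝓝 q, ∀ k ≥ K,
      (Φ k).toEquiv.symm q' = (Φ K).toEquiv.symm q' := by
    intro q hq
    obtain ⟨K, hK⟩ := hfin q hq
    refine ⟨K, ?_⟩
    filter_upwards [hK] with q' hq' k hk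
    induction k, hk using Nat.le_induction with
    | base => rfl
    | succ k hk ih =>
      have h1 : (ψ k).toEquiv.symm q' = q' := by
        rw [Equiv.symm_apply_eq]
        exact (hid k q' fun h => hq' k hk (hCV k h)).symm
      rw [hΦs'', h1, ih]
  obtain ⟨f, hfe⟩ := exists_locally_eventually_eq (fun k => (Φ k).toEquiv) _ hf
  obtain ⟨g, hge⟩ := exists_locally_eventually_eq (fun k => (Φ k).toEquiv.symm) _ hg
  have hfW : ∀ p ∈ W \ Z, f p ∈ W := by
    intro p hp
    obtain ⟨K, hK⟩ := hfe p hp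
    rw [(hK K le_rfl).eq_of_nhds, hW]
    exact hp.1
  have hgW : ∀ q ∈ W, g q ∈ W \ Z := by
    intro q hq
    obtain ⟨K, hK⟩ := hge q hq
    refine ⟨by rw [(hK K le_rfl).eq_of_nhds, hW']; exact hq, fun hgZ => ?_⟩
    have hall : ∀ k ≥ K, q ∈ rayFrom v (a k) ∩ O := by
      intro k hk
      rwa [(hK k hk).eq_of_nhds, ← hray k, Equiv.apply_symm_apply] at hgZ
    obtain ⟨⟨t, -, rfl⟩, htO⟩ := hall K le_rfl
    obtain ⟨j, hj⟩ := hO t htO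
    have h1 := (smul_mem_rayFrom hv).1 (hall _ (le_max_left K j)).1
    exact absurd (hj.trans_le (ha (le_max_right K j))) (not_lt.2 h1)
  refine ⟨f, g, hfW, hgW, fun p hp => ?_, fun q hq => ?_, fun p hp => ?_, fun q hq => ?_,
    fun p hp u w => ?_, {q | ∀ᶠ q' in 𝓝 q, ∀ k, q' ∉ C k}, isOpen_setOfPred_eventually_nhds,
    fun q hq => ?_, ?_⟩
  · obtain ⟨K₁, hK₁⟩ := hfe p hp
    obtain ⟨K₂, hK₂⟩ := hge (f p) (hfW p hp)
    rw [(hK₂ _ (le_max_right K₁ K₂)).eq_of_nhds, (hK₁ _ (le_max_left K₁ K₂)).eq_of_nhds,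
      Equiv.symm_apply_apply]
  · obtain ⟨K₁, hK₁⟩ := hge q hq
    obtain ⟨K₂, hK₂⟩ := hfe (g q) (hgW q hq)
    rw [(hK₂ _ (le_max_right K₁ K₂)).eq_of_nhds, (hK₁ _ (le_max_left K₁ K₂)).eq_of_nhds,
      Equiv.apply_symm_apply]
  · obtain ⟨K, hK⟩ := hfe p hp
    exact (Φ K).contDiff_toFun.contDiffAt.congr_of_eventuallyEq (hK K le_rfl)
  · obtain ⟨K, hK⟩ := hge q hq
    exact (Φ K).contDiff_invFun.contDiffAt.congr_of_eventuallyEq (hK K le_rfl)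
  · obtain ⟨K, hK⟩ := hfe p hp
    rw [(hK K le_rfl).fderiv_eq]
    exact (Φ K).symp p u w
  · obtain ⟨K, hK⟩ := hfin q hq.1
    have h1 : ∀ᶠ q' in 𝓝 q, ∀ k ∈ Iio K, q' ∉ C k :=
      (eventually_all_finite (finite_Iio K)).2 fun k _ =>
        (hC k).isOpen_compl.mem_nhds fun h => hq.2 (hVU k (hCV k h))
    filter_upwards [hK, h1] with q' h2 h3 k
    rcases lt_or_ge k K with h | h
    · exact h3 k h
    · exact fun hk => h2 k h (hCV k hk)
  · rintro p ⟨hpN, hp⟩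
    have h1 : ∀ k, (Φ k).toEquiv p = p := by
      intro k
      induction k with
      | zero => exact hΦ0 p
      | succ k ih => rw [hΦs', ih, hid k p (hpN.self_of_nhds k)]
    obtain ⟨K, hK⟩ := hfe p hp
    rw [(hK K le_rfl).eq_of_nhds, h1]

end General

section Coordinates

open Filter Topology

/-- The standard symplectic form as a bilinear map. -/
def wcanLin (m : ℕ) : EE m →ₗ[ℝ] EE m →ₗ[ℝ] ℝ :=
  LinearMap.mk₂ ℝ (wcan m)
    (fun u v w => by
      simp only [wcan, wB, Prod.fst_add, Prod.snd_add, Pi.add_apply, add_mul,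
        Finset.sum_sub_distrib, Finset.sum_add_distrib]
      ring)
    (fun c u v => by
      simp only [wcan, wB, Prod.smul_fst, Prod.smul_snd, Pi.smul_apply, smul_eq_mul, mul_assoc,
        Finset.sum_sub_distrib, ← Finset.mul_sum]
      ring)
    (fun u v w => by
      simp only [wcan, wB, Prod.fst_add, Prod.snd_add, Pi.add_apply, mul_add,
        Finset.sum_sub_distrib, Finset.sum_add_distrib]
      ring)
    (fun c u v => by
      simp only [wcan, wB, Prod.smul_fst, Prod.smul_snd, Pi.smul_apply, smul_eq_mul,
        mul_left_comm _ c, Finset.sum_sub_distrib, ← Finset.mul_sum]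
      ring)

theorem wcanLin_apply (m : ℕ) (u v : EE m) : wcanLin m u v = wcan m u v := rfl

theorem wcanLin_self (m : ℕ) (u : EE m) : wcanLin m u u = 0 := by
  simp [wcanLin_apply, wcan, wB, mul_comm]

theorem eq_zero_of_wcanLin_eq_zero (m : ℕ) (w : EE m) (h : ∀ u, wcanLin m w u = 0) : w = 0 := by
  simp only [wcanLin_apply] at h
  ext i
  · simpa [wcan, wB] using h ((0, 1), 0)
  · simpa [wcan, wB] using h ((1, 0), 0)
  · simpa [wcan, wB, Pi.single_apply] using h (0, (0, Pi.single i 1))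
  · simpa [wcan, wB, Pi.single_apply] using h (0, (Pi.single i 1, 0))

/-- The symplectic gradient: the map from covectors to vectors determined by `wcan`. -/
def sgrad (m : ℕ) : (EE m →L[ℝ] ℝ) →L[ℝ] EE m :=
  LinearMap.toContinuousLinearMap
    { toFun := fun α => ((α ((0, 1), 0), -α ((1, 0), 0)),
        (fun i => α (0, (0, Pi.single i 1)), fun i => -α (0, (Pi.single i 1, 0))))
      map_add' := fun α β => by
        ext i <;> simp <;> ring
      map_smul' := fun c α => by
        ext i <;> simp }

theorem wcanLin_sgrad (m : ℕ) (α : EE m →L[ℝ] ℝ) (u : EE m) : wcanLin m (sgrad m α) u = α u := by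
  have hu : u = u.1.1 • ((1, 0), 0) + u.1.2 • ((0, 1), 0) +
      (∑ i, u.2.1 i • ((0, (Pi.single i 1, 0)) : EE m) +
        ∑ i, u.2.2 i • ((0, (0, Pi.single i 1)) : EE m)) := by
    ext i <;> simp [Prod.fst_sum, Prod.snd_sum, Finset.sum_apply, Pi.single_apply]
  conv_rhs => rw [hu]
  simp only [map_add, map_sum, map_smul, smul_eq_mul]
  rw [wcanLin_apply]
  simp only [wcan, wB, sgrad, LinearMap.coe_toContinuousLinearMap', LinearMap.coe_mk,
    AddHom.coe_mk, Finset.sum_sub_distrib, ← Finset.sum_add_distrib, neg_mul,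
    Finset.sum_neg_distrib]
  simp only [mul_comm (α _), Finset.sum_add_distrib]
  ring

/-- The positive `x₁`-axis is excisable. -/
theorem excisable_ray (m : ℕ) {U : Set (EE m)} (hU : IsOpen U)
    (hZU : rayFrom (((1, 0), 0) : EE m) 0 ⊆ U) :
    Excisable (wcanLin m) univ (rayFrom (((1, 0), 0) : EE m) 0) U := by
  have hv : (((1, 0), 0) : EE m) ≠ 0 := by simp [Prod.ext_iff]
  have h := excisable_rayFrom_inter (wcanLin_self m) (eq_zero_of_wcanLin_eq_zero m) (sgrad m)
    (wcanLin_sgrad m) hv (W := univ) (O := univ) (U := U) subset_rfl (a := fun k => (k : ℝ))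
    Nat.mono_cast (V := fun k => U ∩ {p | (k : ℝ) - 1 < p.1.1})
    (fun k => hU.inter (isOpen_lt continuous_const (by fun_prop))) (fun k => subset_univ _)
    (fun k => inter_subset_left) ?_ ?_ ?_ ?_
  · simpa using h
  · intro k t ht
    refine ⟨hZU ⟨t, le_trans (Nat.cast_nonneg k) ht.1, rfl⟩, ?_⟩
    have := ht.1
    simp only [mem_ofPred_eq, Prod.smul_fst, smul_eq_mul]
    linarith
  · intro q _
    obtain ⟨K, hK⟩ := exists_nat_gt (q.1.1 + 1)
    refine ⟨K, ?_⟩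
    have h1 : ∀ᶠ q' : EE m in 𝓝 q, q'.1.1 + 1 < K :=
      (isOpen_lt (by fun_prop) continuous_const).mem_nhds hK
    filter_upwards [h1] with q' h2 k hk h3
    have h4 : (k : ℝ) - 1 < q'.1.1 := h3.2
    have h5 : (K : ℝ) ≤ k := by exact_mod_cast hk
    linarith
  · exact fun t _ => exists_nat_gt t
  · rw [univ_inter, inter_univ, (isClosed_rayFrom hv _).closure_eq]

/-- A horn with tip removed at the origin, on the line with direction `(1, s)`, is excisable from
every open set in which it is closed. -/
theorem excisable_horn (m : ℕ) (s : ℝ) {W U : Set (EE m)} (hW : IsOpen W) (hU : IsOpen U)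
    (h0 : (0 : EE m) ∉ W)
    (hseg : ∀ t ∈ Ico (-1 : ℝ) 0, t • (((1, s), 0) : EE m) ∈ W ∩ U) :
    Excisable (wcanLin m) W (rayFrom (((1, s), 0) : EE m) (-1) ∩ (W ∩ {p | p.1.1 < 0})) U ∧
      IsOpen (W \ (rayFrom (((1, s), 0) : EE m) (-1) ∩ (W ∩ {p | p.1.1 < 0}))) := by
  set v : EE m := ((1, s), 0) with hvdef
  have hv : v ≠ 0 := by simp [hvdef, Prod.ext_iff]
  have hfst : ∀ t : ℝ, (t • v).1.1 = t := fun t => by simp [hvdef]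
  have hlt : IsOpen {p : EE m | p.1.1 < 0} := isOpen_lt continuous_fst.fst continuous_const
  have hcl : W ∩ closure (rayFrom v (-1) ∩ (W ∩ {p | p.1.1 < 0})) ⊆
      rayFrom v (-1) ∩ (W ∩ {p | p.1.1 < 0}) := by
    rintro p ⟨hpW, hp⟩
    have h1 : IsClosed (rayFrom v (-1) ∩ {p : EE m | p.1.1 ≤ 0}) :=
      (isClosed_rayFrom hv _).inter (isClosed_le continuous_fst.fst continuous_const)
    have hsub : rayFrom v (-1) ∩ (W ∩ {p | p.1.1 < 0}) ⊆
        rayFrom v (-1) ∩ {p : EE m | p.1.1 ≤ 0} :=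
      fun q hq => ⟨hq.1, le_of_lt (show q.1.1 < 0 from hq.2.2)⟩
    obtain ⟨hpR, hp0⟩ := closure_minimal hsub h1 hp
    refine ⟨hpR, hpW, show p.1.1 < 0 from
      lt_of_le_of_ne (show p.1.1 ≤ 0 from hp0) fun h => h0 ?_⟩
    obtain ⟨t, -, rfl⟩ := hpR
    have ht : t = 0 := by rw [← hfst t]; exact h
    subst ht
    simpa using hpW
  refine ⟨?_, ?_⟩
  · obtain ⟨a, ha⟩ : ∃ a : ℕ → ℝ, ∀ k, a k = -(1 / ((k : ℝ) + 1)) := ⟨_, fun _ => rfl⟩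
    have ha0 : a 0 = -1 := by simp [ha]
    have hamono : Monotone a := fun i j hij => by
      rw [ha, ha]
      exact neg_le_neg (one_div_le_one_div_of_le (by positivity) (by gcongr))
    obtain ⟨V, hV⟩ : ∃ V : ℕ → Set (EE m), ∀ k, V k =
        U ∩ (W ∩ {p | p.1.1 < 0}) ∩ Metric.ball 0 ((‖v‖ + 1) * (1 / ((k : ℝ) + 1))) :=
      ⟨_, fun _ => rfl⟩
    have hVo : ∀ k, IsOpen (V k) := fun k => by
      rw [hV]
      exact (hU.inter (hW.inter hlt)).inter Metric.isOpen_ball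
    have hVO : ∀ k, V k ⊆ W ∩ {p | p.1.1 < 0} := fun k p hp => by
      rw [hV] at hp
      exact hp.1.2
    have hVU : ∀ k, V k ⊆ U := fun k p hp => by
      rw [hV] at hp
      exact hp.1.1
    rw [← ha0] at hcl ⊢
    refine excisable_rayFrom_inter (wcanLin_self m) (eq_zero_of_wcanLin_eq_zero m) (sgrad m)
      (wcanLin_sgrad m) hv inter_subset_left hamono hVo hVO hVU ?_ ?_ ?_ hcl
    · rintro k t ⟨ht1, ht2⟩
      rw [ha] at ht1 ht2
      rw [hV]
      have hk1 : 1 / ((k : ℝ) + 1) ≤ 1 := by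
        rw [div_le_one (by positivity)]
        linarith [(Nat.cast_nonneg k : (0 : ℝ) ≤ k)]
      have hk0 : 0 < 1 / ((k : ℝ) + 1) := by positivity
      have hk2 : 0 < 1 / (((k + 1 : ℕ) : ℝ) + 1) := by positivity
      have ht0 : t < 0 := by linarith
      have hmem := hseg t ⟨by linarith, ht0⟩
      refine ⟨⟨hmem.2, hmem.1, ?_⟩, ?_⟩
      · rw [mem_ofPred_eq, hfst]
        exact ht0
      · rw [mem_ball_zero_iff, norm_smul, Real.norm_eq_abs, abs_of_neg ht0]
        nlinarith [norm_nonneg v]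
    · intro q hq
      have hq0 : 0 < ‖q‖ := norm_pos_iff.2 fun h => h0 (h ▸ hq)
      have hv1 : 0 < ‖v‖ + 1 := by positivity
      obtain ⟨K, hK⟩ := exists_nat_one_div_lt (show 0 < ‖q‖ / 2 / (‖v‖ + 1) by positivity)
      refine ⟨K, ?_⟩
      have h1 : ∀ᶠ q' : EE m in 𝓝 q, ‖q‖ / 2 < ‖q'‖ :=
        (isOpen_lt continuous_const continuous_norm).mem_nhds (half_lt_self hq0)
      filter_upwards [h1] with q' h2 k hk h3
      rw [hV] at h3
      have h4 := mem_ball_zero_iff.1 h3.2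
      rw [lt_div_iff₀ hv1] at hK
      have h5 : 1 / ((k : ℝ) + 1) ≤ 1 / ((K : ℝ) + 1) :=
        one_div_le_one_div_of_le (by positivity) (by gcongr)
      nlinarith
    · rintro t ⟨-, ht⟩
      rw [mem_ofPred_eq, hfst] at ht
      obtain ⟨k, hk⟩ := exists_nat_one_div_lt (neg_pos.2 ht)
      exact ⟨k, by rw [ha]; linarith⟩
  · have h : W \ (rayFrom v (-1) ∩ (W ∩ {p | p.1.1 < 0})) =
        W ∩ (closure (rayFrom v (-1) ∩ (W ∩ {p | p.1.1 < 0})))ᶜ :=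
      Subset.antisymm (fun p hp => ⟨hp.1, fun h => hp.2 (hcl ⟨hp.1, h⟩)⟩)
        fun p hp => ⟨hp.1, fun h => hp.2 (subset_closure h)⟩
    rw [h]
    exact hW.inter isClosed_closure.isOpen_compl

theorem isClosed_rayWithHorns (m : ℕ) : IsClosed (rayWithHorns m) := by
  have h1 : IsClosed {z : EE m | z.2 = 0} := isClosed_eq continuous_snd continuous_const
  have h2 : IsClosed {z : EE m | z.1.2 = 0 ∧ 0 ≤ z.1.1} :=
    (isClosed_eq continuous_fst.snd continuous_const).inter
      (isClosed_le continuous_const continuous_fst.fst)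
  have h3 : IsClosed {z : EE m | z.1.1 = -|z.1.2|} :=
    isClosed_eq continuous_fst.fst continuous_fst.snd.abs.neg
  have h4 : IsClosed {z : EE m | z.1.2 ∈ Icc (-1 : ℝ) 1 ∧ z.1.1 = -|z.1.2|} :=
    (isClosed_Icc.preimage (continuous_fst.snd : Continuous fun z : EE m => z.1.2)).inter h3
  exact h1.inter (h2.union h4)

theorem mem_rayFrom_coord {m : ℕ} {s a : ℝ} {p : EE m} :
    p ∈ rayFrom (((1, s), 0) : EE m) a ↔ a ≤ p.1.1 ∧ p.1.2 = p.1.1 * s ∧ p.2 = 0 := by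
  constructor
  · rintro ⟨t, ht, rfl⟩
    simpa using ht
  · rintro ⟨h1, h2, h3⟩
    exact ⟨p.1.1, h1, Prod.ext (Prod.ext (by simp) (by simp [h2])) (by simp [h3])⟩

/-- The ray with two horns is excisable: first one horn, then the other horn, each without the
origin, and finally the ray. -/
theorem excisable_rayWithHorns (m : ℕ) {U : Set (EE m)} (hU : IsOpen U)
    (hZU : rayWithHorns m ⊆ U) : Excisable (wcanLin m) univ (rayWithHorns m) U := by
  set R := rayFrom (((1, 0), 0) : EE m) 0 with hR
  have hRZ : R ⊆ rayWithHorns m := fun p hp => by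
    obtain ⟨h1, h2, h3⟩ := mem_rayFrom_coord.1 hp
    exact ⟨h3, Or.inl ⟨by simpa using h2, h1⟩⟩
  have hRc : IsClosed R := isClosed_rayFrom (by simp [Prod.ext_iff]) _
  have h0 : (0 : EE m) ∈ R := mem_rayFrom_coord.2 (by simp)
  have hneg : ∀ p : EE m, p.1.1 < 0 → p ∉ R := fun p hp h =>
    absurd (mem_rayFrom_coord.1 h).1 (not_le.2 hp)
  have hhorn : ∀ s : ℝ, |s| = 1 → ∀ t ∈ Ico (-1 : ℝ) 0,
      t • (((1, s), 0) : EE m) ∈ rayWithHorns m := by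
    rintro s hs t ⟨ht1, ht0⟩
    have habs : |t * s| = -t := by rw [abs_mul, hs, mul_one, abs_of_neg ht0]
    refine ⟨by simp, Or.inr ⟨?_, ?_⟩⟩
    · have := abs_le.1 (habs.le.trans (by linarith : -t ≤ 1))
      simpa using this
    · simp [habs]
  obtain ⟨e₁, ho₁⟩ := excisable_horn m (-1) (W := univ \ R) (U := U)
    (by rw [← compl_eq_univ_sdiff]; exact hRc.isOpen_compl) hU (fun h => h.2 h0)
    (fun t ht => ⟨⟨mem_univ _, hneg _ (by simpa using ht.2)⟩, hZU (hhorn _ (by simp) t ht)⟩)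
  set Z₁ := rayFrom (((1, -1), 0) : EE m) (-1) ∩ (univ \ R ∩ {p | p.1.1 < 0}) with hZ₁
  obtain ⟨e₂, -⟩ := excisable_horn m 1 (W := (univ \ R) \ Z₁) (U := U)
    ho₁ hU (fun h => h.1.2 h0)
    (fun t ht => ⟨⟨⟨mem_univ _, hneg _ (by simpa using ht.2)⟩, fun h => by
        have h1 := (mem_rayFrom_coord.1 h.1).2.1
        have h2 := ht.2
        simp at h1
        linarith⟩, hZU (hhorn _ (by simp) t ht)⟩)
  set Z₂ := rayFrom (((1, 1), 0) : EE m) (-1) ∩ (((univ \ R) \ Z₁) ∩ {p | p.1.1 < 0}) with hZ₂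
  have hsub : ∀ s : ℝ, |s| = 1 → ∀ p ∈ rayFrom (((1, s), 0) : EE m) (-1), p.1.1 < 0 →
      p ∈ rayWithHorns m := by
    rintro s hs _ ⟨t, ht, rfl⟩ hp
    exact hhorn s hs t ⟨ht, by simpa using hp⟩
  have hZ₁Z : Z₁ ⊆ rayWithHorns m := fun p hp => hsub _ (by simp) p hp.1 hp.2.2
  have hZ₂Z : Z₂ ⊆ rayWithHorns m := fun p hp => hsub _ (by simp) p hp.1 hp.2.2
  have hunion : R ∪ (Z₁ ∪ Z₂) = rayWithHorns m := by
    refine Subset.antisymm (union_subset hRZ (union_subset hZ₁Z hZ₂Z)) ?_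
    rintro p ⟨hp2, ⟨hy, hx⟩ | ⟨⟨hy1, hy2⟩, hx⟩⟩
    · exact Or.inl (mem_rayFrom_coord.2 ⟨hx, by simpa using hy, hp2⟩)
    · rcases lt_trichotomy p.1.2 0 with hy | hy | hy
      · right
        by_cases hpZ : p ∈ Z₁
        · exact Or.inl hpZ
        · rw [abs_of_neg hy] at hx
          have hx0 : p.1.1 < 0 := by linarith
          exact Or.inr ⟨mem_rayFrom_coord.2 ⟨by linarith, by linarith, hp2⟩,
            ⟨⟨mem_univ _, hneg p hx0⟩, hpZ⟩, hx0⟩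
      · rw [hy] at hx
        exact Or.inl (mem_rayFrom_coord.2 ⟨by simp [hx], by simp [hy], hp2⟩)
      · rw [abs_of_pos hy] at hx
        have hx0 : p.1.1 < 0 := by linarith
        exact Or.inr (Or.inl ⟨mem_rayFrom_coord.2 ⟨by linarith, by linarith, hp2⟩,
          ⟨mem_univ _, hneg p hx0⟩, hx0⟩)
  rw [← hunion]
  exact (excisable_ray m hU (hRZ.trans hZU)).union (e₁.union e₂ (hZ₁Z.trans hZU)) (hRZ.trans hZU)

end Coordinates

/-- The "ray with two horns" is symplectically neighbourhood excisable from
`(ℝ^{2n}, ω_can)`: for every open neighbourhood `U` of `Z` there is a symplectomorphism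
`φ` from `ℝ^{2n} ∖ Z` onto `ℝ^{2n}` that is the identity on some neighbourhood of
`ℝ^{2n} ∖ U` in `ℝ^{2n} ∖ Z`. -/
theorem rayWithHorns_symplectically_neighbourhood_excisable (m : ℕ)
    (U : Set (EE m)) (hU : IsOpen U) (hZU : rayWithHorns m ⊆ U) :
    ∃ φ : EE m → EE m,
      ContDiffOn ℝ (⊤ : ℕ∞) φ (rayWithHorns m)ᶜ ∧
      BijOn φ (rayWithHorns m)ᶜ univ ∧
      (∃ ψ : EE m → EE m, ContDiff ℝ (⊤ : ℕ∞) ψ ∧ InvOn ψ φ (rayWithHorns m)ᶜ univ) ∧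
      (∀ z ∉ rayWithHorns m, ∀ u v,
        wcan m (fderiv ℝ φ z u) (fderiv ℝ φ z v) = wcan m u v) ∧
      (∃ V : Set (EE m), IsOpen V ∧ univ \ U ⊆ V ∧ V ⊆ (rayWithHorns m)ᶜ ∧
        EqOn φ id V) := by
  obtain ⟨f, g, hfm, hgm, hgf, hfg, hfs, hgs, hsymp, N, hN, hUN, hid⟩ :=
    excisable_rayWithHorns m hU hZU
  rw [← compl_eq_univ_sdiff] at hfm hgm hgf hfs hsymp hid
  have hinv : InvOn g f (rayWithHorns m)ᶜ univ := ⟨hgf, hfg⟩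
  refine ⟨f, fun p hp => (hfs p hp).contDiffWithinAt, hinv.bijOn hfm hgm,
    ⟨g, contDiff_iff_contDiffAt.2 fun q => hgs q (mem_univ q), hinv⟩, hsymp,
    N ∩ (rayWithHorns m)ᶜ, hN.inter (isClosed_rayWithHorns m).isOpen_compl,
    fun p hp => ⟨hUN hp, fun h => hp.2 (hZU h)⟩, inter_subset_right, hid⟩
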